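/- arXiv:1807.05514 — 2 statements merged into one kernel-verified Lean document; each statement's English description precedes it below -/
import Mathlib

section
/- For temporary exchange instances with a fixed finite agent set N in which all agents have tenant-predominant preferences, there exists a strategyproof mechanism that always returns a core stable and Pareto optimal allocation. That is, there is a function f mapping each tenant-predominant preference profile to an allocation, such that f(≿) is core stable and Pareto optimal for every profile, and no agent i can obtain a strictly preferred outcome (with respect to her true tenant-predominant preference) by reporting a different tenant-predominant preference. -/
open scoped Classical

/-- The outcome of agent `i` under allocation `σ`: the owner of the house `i` receives,
and the tenant who receives `i`'s own house. -/
def outcome {N : Type*} (σ : Equiv.Perm N) (i : N) : N × N := (σ i, σ.symm i)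

/-- Strict preference derived from a weak preference relation `r`. -/
def SPref {α : Type*} (r : α → α → Prop) (a b : α) : Prop := r a b ∧ ¬ r b a

/-- A nonempty coalition `S` blocks allocation `σ`: there is a permutation `τ` of `S`
(fixing all agents outside `S`) under which every member of `S` is strictly better off. -/
def Blocks {N : Type*} (pref : N → (N × N) → (N × N) → Prop)
    (σ : Equiv.Perm N) (S : Set N) : Prop :=
  S.Nonempty ∧ ∃ τ : Equiv.Perm N, (∀ i ∉ S, τ i = i) ∧
    ∀ i ∈ S, SPref (pref i) (outcome τ i) (outcome σ i)

/-- An allocation is core stable if no coalition blocks it. -/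
def CoreStable {N : Type*} (pref : N → (N × N) → (N × N) → Prop) (σ : Equiv.Perm N) : Prop :=
  ∀ S : Set N, ¬ Blocks pref σ S

/-- An allocation `σ` is Pareto optimal if no allocation makes every agent weakly
better off and some agent strictly better off. -/
def ParetoOptimal {N : Type*} (pref : N → (N × N) → (N × N) → Prop)
    (σ : Equiv.Perm N) : Prop :=
  ¬ ∃ τ : Equiv.Perm N, (∀ i, pref i (outcome τ i) (outcome σ i)) ∧
      ∃ j, SPref (pref j) (outcome τ j) (outcome σ j)

/-- The tenant-predominant (weak) preference over outcomes induced by a strict order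
`ns` over tenants and a strict order `hs` over house-owners: lexicographic with
tenants first. -/
def tenantPredPref {N : Type*} (ns hs : N → N → Prop) (a b : N × N) : Prop :=
  ns a.2 b.2 ∨ (a.2 = b.2 ∧ (hs a.1 b.1 ∨ a.1 = b.1))

/-- `g` is an outcome of top trading cycles for the strict preferences `R` (`R i a b`: agent `i`
prefers `a` to `b`), where `r` records the round in which each agent trades: agents trade within
a round, and whatever an agent prefers to her assignment has left in an earlier round. -/
structure IsTopTrading {N : Type*} (R : N → N → N → Prop) (g : Equiv.Perm N) (r : N → ℕ) :
    Prop where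
  round_apply : ∀ i, r (g i) = r i
  round_lt : ∀ i j, R i j (g i) → r j < r i

theorem exists_topTrading_on {N : Type*} [Finite N] (R : N → N → N → Prop)
    (hR : ∀ i, IsStrictTotalOrder N (R i)) (A : Set N) :
    ∃ (g : N → N) (r : N → ℕ), Set.MapsTo g A A ∧ Set.InjOn g A ∧ (∀ i ∈ A, r (g i) = r i) ∧
      ∀ i ∈ A, ∀ j ∈ A, R i j (g i) → r j < r i := by
  induction A using WellFoundedLT.induction with
  | ind A ih =>
  rcases A.eq_empty_or_nonempty with rfl | hA
  · exact ⟨id, 0, by simp, by simp, by simp, by simp⟩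
  have htop : ∀ i, ∃ m ∈ A, ∀ x ∈ A, ¬ R i x m := fun i =>
    have := hR i
    (Finite.wellFounded_of_trans_of_irrefl (R i)).has_min A hA
  choose t htA htop using htop
  have hCA : Function.periodicPts t ⊆ A := by
    intro x hx
    obtain ⟨y, -, rfl⟩ := (Function.bijOn_periodicPts t).surjOn hx
    exact htA y
  obtain ⟨c, hc⟩ : (Function.periodicPts t).Nonempty := by
    obtain ⟨a, -⟩ := hA
    obtain ⟨m, n, hmn, h⟩ := Finite.exists_ne_map_eq_of_infinite (fun n : ℕ => t^[n] a)
    wlog hlt : m < n generalizing m n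
    · exact this n m hmn.symm h.symm (by omega)
    refine ⟨t^[m] a, Function.mk_mem_periodicPts (n := n - m) (by omega) ?_⟩
    rw [Function.IsPeriodicPt, Function.IsFixedPt, ← Function.iterate_add_apply,
      Nat.sub_add_cancel hlt.le]
    exact h.symm
  have hbij := Function.bijOn_periodicPts t
  generalize Function.periodicPts t = C at *
  obtain ⟨g, r, hmaps, hinj, hround, hlt⟩ := ih (A \ C)
    ⟨Set.sdiff_subset, fun h => (h (hCA hc)).2 hc⟩
  refine ⟨fun x => if x ∈ C then t x else g x, fun x => if x ∈ C then 0 else r x + 1,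
    fun x hx => ?_, fun x hx y hy hxy => ?_, fun x hx => ?_, fun x hx y hy hxy => ?_⟩
  · by_cases h : x ∈ C
    · simpa [h] using htA x
    · simpa [h] using (hmaps ⟨hx, h⟩).1
  · by_cases h : x ∈ C <;> by_cases h' : y ∈ C <;> simp only [h, h', if_true, if_false] at hxy
    · exact hbij.injOn h h' hxy
    · exact absurd (hxy ▸ hbij.mapsTo h) (hmaps ⟨hy, h'⟩).2
    · exact absurd (hxy ▸ hbij.mapsTo h') (hmaps ⟨hx, h⟩).2
    · exact hinj ⟨hx, h⟩ ⟨hy, h'⟩ hxy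
  · by_cases h : x ∈ C
    · simp [h, hbij.mapsTo h]
    · simp [h, (hmaps ⟨hx, h⟩).2, hround x ⟨hx, h⟩]
  · by_cases h : x ∈ C
    · simp only [h, if_true] at hxy
      exact absurd hxy (htop x y hy)
    · by_cases h' : y ∈ C
      · simp [h, h']
      · simp only [h, if_false] at hxy
        simpa [h, h'] using hlt x ⟨hx, h⟩ y ⟨hy, h'⟩ hxy

theorem exists_isTopTrading {N : Type*} [Finite N] (R : N → N → N → Prop)
    (hR : ∀ i, IsStrictTotalOrder N (R i)) : ∃ g r, IsTopTrading R g r := by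
  obtain ⟨g, r, -, hinj, hround, hlt⟩ := exists_topTrading_on R hR Set.univ
  refine ⟨Equiv.ofBijective g (Finite.injective_iff_bijective.mp (Set.injOn_univ.mp hinj)), r,
    ?_, ?_⟩
  · simpa using hround
  · simpa using hlt

/-- A coalition that can weakly improve on a top trading outcome already receives it. -/
theorem IsTopTrading.eq_of_weakly_improves {N : Type*} [Fintype N] {R : N → N → N → Prop}
    {g : Equiv.Perm N} {r : N → ℕ} (hg : IsTopTrading R g r) (τ : Equiv.Perm N) (S : Set N)
    (hτ : ∀ i ∉ S, τ i = i) (h : ∀ i ∈ S, R i (τ i) (g i) ∨ τ i = g i) :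
    ∀ i ∈ S, τ i = g i := by
  have hle : ∀ i ∈ Finset.univ, r (τ i) ≤ r i := by
    intro i _
    by_cases hi : i ∈ S
    · rcases h i hi with h | h
      · exact (hg.round_lt _ _ h).le
      · rw [h, hg.round_apply]
    · rw [hτ i hi]
  have heq := (Finset.sum_eq_sum_iff_of_le hle).mp (Equiv.sum_comp τ r)
  intro i hi
  refine (h i hi).resolve_left fun h => ?_
  exact (hg.round_lt _ _ h).ne (heq i (Finset.mem_univ i))

/-- If only agent `i` changes her preferences and her assignment does not get worse,
then the top trading outcome does not change at all. -/
theorem IsTopTrading.eq_of_unilateral {N : Type*} [Fintype N] {R R' : N → N → N → Prop}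
    {g g' : Equiv.Perm N} {r r' : N → ℕ} (hg : IsTopTrading R g r) (hg' : IsTopTrading R' g' r')
    (hR : ∀ i, IsStrictTotalOrder N (R i)) (i : N) (hne : ∀ j, j ≠ i → R' j = R j)
    (hi : R i (g' i) (g i) ∨ g' i = g i) : g' = g := by
  suffices H : ∀ k j, r j = k → g' j = g j from Equiv.ext fun j => H _ j rfl
  intro k
  induction k using Nat.strong_induction_on with
  | _ k ih =>
  have hge : ∀ j, r j = k → ¬ r (g' j) < k := by
    intro j hj hlt
    have hround : r (g.symm (g' j)) = r (g' j) := by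
      rw [← hg.round_apply, Equiv.apply_symm_apply]
    have hfix := ih _ hlt _ hround
    rw [Equiv.apply_symm_apply, g'.injective.eq_iff] at hfix
    rw [← hround, hfix] at hlt
    omega
  have hcases : ∀ j, r j = k → g' j = g j ∨ r' (g j) < r' j := by
    intro j hj
    have hworse : ¬ R j (g' j) (g j) := fun h => hge j hj (hj ▸ hg.round_lt _ _ h)
    by_cases hji : j = i
    · subst hji
      exact Or.inl (hi.resolve_left hworse)
    · have := hR j
      rcases trichotomous_of (R j) (g' j) (g j) with h | h | h
      · exact absurd h hworse
      · exact Or.inl h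
      · exact Or.inr (hg'.round_lt _ _ (hne j hji ▸ h))
  have hle : ∀ j ∈ Finset.univ.filter (r · = k), r' (g j) ≤ r' j := by
    intro j hj
    rcases hcases j (Finset.mem_filter.mp hj).2 with h | h
    · rw [← h, hg'.round_apply]
    · exact h.le
  have hsum : ∑ j ∈ Finset.univ.filter (r · = k), r' (g j) =
      ∑ j ∈ Finset.univ.filter (r · = k), r' j :=
    Finset.sum_equiv g (by simp [hg.round_apply]) (by simp)
  have heq := (Finset.sum_eq_sum_iff_of_le hle).mp hsum
  intro j hj
  exact (hcases j hj).resolve_right (heq j (by simp [hj])).not_lt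

theorem SPref.irrefl {α : Type*} (r : α → α → Prop) (a : α) : ¬ SPref r a a :=
  fun h => h.2 h.1

theorem tenantPredPref.tenant {N : Type*} {ns hs : N → N → Prop} {a b : N × N}
    (h : tenantPredPref ns hs a b) : ns a.2 b.2 ∨ a.2 = b.2 :=
  h.imp_right And.left

/-- No coalition has a reallocation that all its members weakly prefer to a top trading outcome and
that is strictly better for one of them. -/
theorem IsTopTrading.not_weakly_blocked {N : Type*} [Fintype N]
    {p : N → (N → N → Prop) × (N → N → Prop)} {g : Equiv.Perm N} {r : N → ℕ}
    (hg : IsTopTrading (fun i => (p i).1) g r) (τ : Equiv.Perm N) (S : Set N)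
    (hτ : ∀ i ∉ S, τ i = i)
    (h : ∀ i ∈ S, tenantPredPref (p i).1 (p i).2 (outcome τ i) (outcome g.symm i))
    {i : N} (hi : i ∈ S) :
    ¬ SPref (tenantPredPref (p i).1 (p i).2) (outcome τ i) (outcome g.symm i) := by
  have hτ' : ∀ j ∉ S, τ.symm j = j := fun j hj => by
    rw [Equiv.symm_apply_eq, hτ j hj]
  have heq := hg.eq_of_weakly_improves τ.symm S hτ' fun j hj => (h j hj).tenant
  have hmem : τ i ∈ S := by
    by_contra hn
    exact hn (by rwa [τ.injective (hτ _ hn)])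
  have house : τ i = g.symm i := by
    rw [Equiv.eq_symm_apply, ← heq _ hmem, Equiv.symm_apply_apply]
  have hout : outcome τ i = outcome g.symm i := by
    simp only [outcome, Equiv.symm_symm, heq i hi, house]
  rw [hout]
  exact SPref.irrefl _ _

/-- for a fixed finite agent set with tenant-predominant preferences,
there is a strategyproof mechanism that always returns a core stable and Pareto
optimal allocation. A profile assigns to each agent a pair of strict total orders
(over tenants and over house-owners); the induced preference is lexicographic with
tenants first. -/
theorem tenant_predominant_SP_mechanism {N : Type*} [Fintype N] [DecidableEq N] :
    ∃ f : (N → (N → N → Prop) × (N → N → Prop)) → Equiv.Perm N,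
      (∀ p : N → (N → N → Prop) × (N → N → Prop),
        (∀ i, IsStrictTotalOrder N (p i).1 ∧ IsStrictTotalOrder N (p i).2) →
          CoreStable (fun i => tenantPredPref (p i).1 (p i).2) (f p) ∧
          ParetoOptimal (fun i => tenantPredPref (p i).1 (p i).2) (f p)) ∧
      (∀ p : N → (N → N → Prop) × (N → N → Prop),
        (∀ i, IsStrictTotalOrder N (p i).1 ∧ IsStrictTotalOrder N (p i).2) →
        ∀ (i : N) (q : (N → N → Prop) × (N → N → Prop)),
          IsStrictTotalOrder N q.1 → IsStrictTotalOrder N q.2 →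
          ¬ SPref (tenantPredPref (p i).1 (p i).2)
              (outcome (f (Function.update p i q)) i) (outcome (f p) i)) := by
  have hex : ∀ p : N → (N → N → Prop) × (N → N → Prop), ∃ g : Equiv.Perm N,
      (∀ i, IsStrictTotalOrder N (p i).1 ∧ IsStrictTotalOrder N (p i).2) →
        ∃ r, IsTopTrading (fun i => (p i).1) g r := by
    intro p
    by_cases hp : ∀ i, IsStrictTotalOrder N (p i).1 ∧ IsStrictTotalOrder N (p i).2
    · obtain ⟨g, r, hg⟩ := exists_isTopTrading (fun i => (p i).1) fun i => (hp i).1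
      exact ⟨g, fun _ => ⟨r, hg⟩⟩
    · exact ⟨1, fun h => absurd h hp⟩
  choose g hg using hex
  refine ⟨fun p => (g p).symm, fun p hp => ?_, fun p hp i q hq₁ hq₂ hsp => ?_⟩
  · obtain ⟨r, hr⟩ := hg p hp
    constructor
    · rintro S ⟨⟨i, hi⟩, τ, hτ, h⟩
      exact hr.not_weakly_blocked τ S hτ (fun j hj => (h j hj).1) hi (h i hi)
    · rintro ⟨τ, h, j, hj⟩
      exact hr.not_weakly_blocked τ Set.univ (fun i hi => absurd (Set.mem_univ i) hi)
        (fun i _ => h i) (Set.mem_univ j) hj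
  · obtain ⟨r, hr⟩ := hg p hp
    obtain ⟨r', hr'⟩ := hg (Function.update p i q) fun j => by
      by_cases hj : j = i
      · subst hj
        simpa using ⟨hq₁, hq₂⟩
      · simpa [Function.update_of_ne hj] using hp j
    have heq := hr.eq_of_unilateral hr' (fun j => (hp j).1) i
      (fun j hj => by simp only [Function.update_of_ne hj]) hsp.1.tenant
    simp only [heq] at hsp
    exact SPref.irrefl _ _ hsp
end

section
/- In the responsive temporary exchange setting, if every agent's underlying preference ≿_i^N over tenants is a strict linear order (while her preference ≿_i^H over house-owners is an arbitrary total preorder), then an RS core stable allocation exists. -/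
open scoped Classical

/-- `r` is a total preorder: total and transitive. -/
def TotalPreorderRel {α : Type*} (r : α → α → Prop) : Prop :=
  (∀ a b, r a b ∨ r b a) ∧ (∀ a b c, r a b → r b c → r a c)

/-- Strict preference in the responsive set extension determined by a weak preference
`hw` over house-owners and a weak preference `nw` over tenants: `(h, j)` is strictly
RS-preferred to `(h', j')` if `h ≿ᴴ h'` and `j ≿ᴺ j'`, with at least one of the two
comparisons strict. -/
def RSstrict {N : Type*} (hw nw : N → N → Prop) (a b : N × N) : Prop :=
  hw a.1 b.1 ∧ nw a.2 b.2 ∧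
    ((hw a.1 b.1 ∧ ¬ hw b.1 a.1) ∨ (nw a.2 b.2 ∧ ¬ nw b.2 a.2))

/-- A nonempty coalition `S` RS-blocks allocation `σ`: there is a permutation `τ` of `S`
(fixing all agents outside `S`) under which every member of `S` is strictly RS-better off. -/
def RSBlocks {N : Type*} (hw nw : N → N → N → Prop)
    (σ : Equiv.Perm N) (S : Set N) : Prop :=
  S.Nonempty ∧ ∃ τ : Equiv.Perm N, (∀ i ∉ S, τ i = i) ∧
    ∀ i ∈ S, RSstrict (hw i) (nw i) (outcome τ i) (outcome σ i)

/-- An allocation is RS core stable if no coalition RS-blocks it. -/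
def RSCoreStable {N : Type*} (hw nw : N → N → N → Prop) (σ : Equiv.Perm N) : Prop :=
  ∀ S : Set N, ¬ RSBlocks hw nw σ S

/-- A self-map of a nonempty finite type has a periodic point. -/
theorem periodicPts_nonempty_of_finite {N : Type*} [Finite N] [Nonempty N] (f : N → N) :
    (Function.periodicPts f).Nonempty := by
  obtain ⟨x⟩ := ‹Nonempty N›
  obtain ⟨m, n, hmn, h⟩ := Set.finite_univ.exists_lt_map_eq_of_forall_mem
    (f := fun n => f^[n] x) (fun _ => Set.mem_univ _)
  refine ⟨f^[m] x, n - m, by omega, ?_⟩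
  change f^[n - m] (f^[m] x) = f^[m] x
  rw [← Function.iterate_add_apply, Nat.sub_add_cancel hmn.le]
  exact h.symm

/-- Top trading cycles: for strict preferences `r i` (with `r i a b` meaning that `i` strictly
prefers `a` to `b`), the agents in `A` can be assigned to each other so that any reassignment
within a subset of `A` that harms none of its members leaves all their assignments unchanged. -/
theorem exists_ttc_assignment {N : Type*} [Finite N] (r : N → N → N → Prop)
    (hr : ∀ i, WellFounded (r i)) (A : Set N) :
    ∃ σ : N → N, Set.MapsTo σ A A ∧ Set.InjOn σ A ∧
      ∀ S ⊆ A, ∀ τ : N → N, Set.MapsTo τ S S → Set.InjOn τ S →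
        (∀ i ∈ S, r i (τ i) (σ i) ∨ τ i = σ i) → Set.EqOn τ σ S := by
  induction A using WellFoundedLT.induction with
  | ind A ih =>
  rcases A.eq_empty_or_nonempty with rfl | hA
  · refine ⟨id, by simp, by simp, fun S hS τ _ _ _ i hi => (hS hi).elim⟩
  choose f hfA hf using fun i => (hr i).has_min A hA
  set C := Function.periodicPts f
  have hbij : Set.BijOn f C C := Function.bijOn_periodicPts f
  have hCA : C ⊆ A := fun i hi => by
    obtain ⟨j, -, rfl⟩ := hbij.surjOn hi
    exact hfA j
  have hCne : C.Nonempty :=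
    haveI : Nonempty N := ⟨hA.some⟩
    periodicPts_nonempty_of_finite f
  have hlt : A \ C < A := by
    refine Set.sdiff_subset.ssubset_of_ne fun h => ?_
    obtain ⟨c, hc⟩ := hCne
    exact (h.symm ▸ hCA hc : c ∈ A \ C).2 hc
  obtain ⟨σ, hmaps, hinj, hcore⟩ := ih (A \ C) hlt
  have hσC : ∀ i ∈ C, C.piecewise f σ i = f i := fun i hi => Set.piecewise_eq_of_mem _ _ _ hi
  have hσC' : ∀ i ∉ C, C.piecewise f σ i = σ i :=
    fun i hi => Set.piecewise_eq_of_notMem _ _ _ hi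
  refine ⟨C.piecewise f σ, ?_, ?_, ?_⟩
  · intro i hi
    by_cases hiC : i ∈ C
    · rw [hσC i hiC]
      exact hfA i
    · rw [hσC' i hiC]
      exact (hmaps ⟨hi, hiC⟩).1
  · intro i hi j hj hij
    by_cases hiC : i ∈ C <;> by_cases hjC : j ∈ C
    · rw [hσC i hiC, hσC j hjC] at hij
      exact hbij.injOn hiC hjC hij
    · rw [hσC i hiC, hσC' j hjC] at hij
      exact ((hmaps ⟨hj, hjC⟩).2 (hij ▸ hbij.mapsTo hiC)).elim
    · rw [hσC' i hiC, hσC j hjC] at hij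
      exact ((hmaps ⟨hi, hiC⟩).2 (hij ▸ hbij.mapsTo hjC)).elim
    · rw [hσC' i hiC, hσC' j hjC] at hij
      exact hinj ⟨hi, hiC⟩ ⟨hj, hjC⟩ hij
  · intro S hSA τ hτS hτinj hτ
    have hτf : ∀ i ∈ S ∩ C, τ i = f i := fun i hi => by
      have h := hτ i hi.1
      rw [hσC i hi.2] at h
      exact h.resolve_left (hf i _ (hSA (hτS hi.1)))
    have hτSC : Set.MapsTo τ (S ∩ C) (S ∩ C) := fun i hi =>
      ⟨hτS hi.1, hτf i hi ▸ hbij.mapsTo hi.2⟩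
    have hsurj : Set.SurjOn τ (S ∩ C) (S ∩ C) :=
      ((Set.toFinite (S ∩ C)).injOn_iff_bijOn_of_mapsTo hτSC).1
        (hτinj.mono Set.inter_subset_left) |>.surjOn
    have hτSdiff : Set.MapsTo τ (S \ C) (S \ C) := fun i hi => by
      refine ⟨hτS hi.1, fun hc => ?_⟩
      obtain ⟨j, hj, hji⟩ := hsurj ⟨hτS hi.1, hc⟩
      exact hi.2 (hτinj hj.1 hi.1 hji ▸ hj.2)
    have hrest := hcore (S \ C) (Set.sdiff_subset_sdiff_left hSA) τ hτSdiff
      (hτinj.mono Set.sdiff_subset) fun i hi => hσC' i hi.2 ▸ hτ i hi.1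
    intro i hi
    by_cases hiC : i ∈ C
    · rw [hσC i hiC, hτf i ⟨hi, hiC⟩]
    · rw [hσC' i hiC, hrest ⟨hi, hiC⟩]

/-- in the responsive setting, if every agent's preference over tenants
is a strict linear order (its weak version being `ns i a b ∨ a = b`) while her
preference over house-owners is an arbitrary total preorder, then an RS core stable
allocation exists. -/
theorem RS_core_exists_of_strict_tenant_prefs {N : Type*} [Fintype N]
    (hw : N → N → N → Prop) (ns : N → N → N → Prop)
    (hhw : ∀ i, TotalPreorderRel (hw i))
    (hns : ∀ i, IsStrictTotalOrder N (ns i)) :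
    ∃ σ : Equiv.Perm N, RSCoreStable hw (fun i a b => ns i a b ∨ a = b) σ := by
  have hr : ∀ i, WellFounded (ns i) := fun i =>
    haveI := hns i
    Finite.wellFounded_of_trans_of_irrefl (ns i)
  obtain ⟨f, -, hinj, hcore⟩ := exists_ttc_assignment ns hr Set.univ
  let e : Equiv.Perm N :=
    Equiv.ofBijective f (Finite.injective_iff_bijective.1 (Set.injOn_univ.1 hinj))
  refine ⟨e.symm, ?_⟩
  rintro S ⟨⟨i, hi⟩, τ, hfix, hblock⟩
  have hτS : ∀ j ∈ S, τ j ∈ S := fun j hj => by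
    by_contra h
    exact h ((τ.injective (hfix _ h)).symm ▸ hj)
  have hτS' : Set.MapsTo τ.symm S S := fun j hj => by
    by_contra h
    have hfixed := hfix _ h
    rw [τ.apply_symm_apply] at hfixed
    exact h (hfixed ▸ hj)
  have heq : ∀ j ∈ S, τ.symm j = e j :=
    hcore S (Set.subset_univ S) τ.symm hτS' τ.symm.injective.injOn fun j hj => (hblock j hj).2.1
  have hout : outcome τ i = outcome e.symm i := by
    refine Prod.ext ?_ (heq i hi)
    change τ i = e.symm i
    rw [Equiv.eq_symm_apply, ← heq _ (hτS i hi), τ.symm_apply_apply]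
  have h := (hblock i hi).2.2
  rw [hout] at h
  exact h.elim (fun h => h.2 h.1) (fun h => h.2 h.1)
end
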